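/- Every equidistributed infinite permutation is aperiodic: there is no t ≥ 1 such that for all sufficiently large i, j, the conditions α[i] ≺ α[j] and α[i+t] ≺ α[j+t] are equivalent. -/

import Mathlib

open Filter

/-- `a` is a representative of the infinite permutation (linear order on ℕ) `r`. -/
def Represents (a : ℕ → ℝ) (r : ℕ → ℕ → Prop) : Prop :=
  ∀ i j : ℕ, r i j ↔ a i < a j

/-- An equidistributed sequence of pairwise distinct reals in `[0,1]`. -/
def EquidistSeq (a : ℕ → ℝ) : Prop :=
  (∀ n, a n ∈ Set.Icc (0:ℝ) 1) ∧ Function.Injective a ∧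
    ∀ t ∈ Set.Icc (0:ℝ) 1,
      Tendsto (fun n => (((Finset.range n).filter fun i => a i < t).card : ℝ) / n)
        atTop (nhds t)

/-- An equidistributed infinite permutation. -/
def EquidistPerm (r : ℕ → ℕ → Prop) : Prop :=
  ∃ a : ℕ → ℝ, EquidistSeq a ∧ Represents a r

/-- `r` has an `N`-monotone subpermutation. -/
def HasNMonotone (r : ℕ → ℕ → Prop) (N : ℕ) : Prop :=
  ∃ n : ℕ → ℕ, StrictMono n ∧ (∀ i, n (i+1) - n i ≤ N) ∧
    ((∀ i, r (n i) (n (i+1))) ∨ (∀ i, r (n (i+1)) (n i)))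

/-- `r` is ultimately `t`-periodic. -/
def UltPeriodicPerm (r : ℕ → ℕ → Prop) (t : ℕ) : Prop :=
  ∃ n0 : ℕ, ∀ i ≥ n0, ∀ j ≥ n0, (r i j ↔ r (i+t) (j+t))

/-- `α[i]` is an `N`-maximal element of `r`. -/
def NMaximal (r : ℕ → ℕ → Prop) (N i : ℕ) : Prop :=
  N < i ∧ ∀ j, j ≠ i → i ≤ j + N → j ≤ i + N → r j i

/-- `α[i]` is an `N`-minimal element of `r`. -/
def NMinimal (r : ℕ → ℕ → Prop) (N i : ℕ) : Prop :=
  N < i ∧ ∀ j, j ≠ i → i ≤ j + N → j ≤ i + N → r i j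

/-- The factor (order type) of length `n` of `r` at position `m`. -/
def permFactor (r : ℕ → ℕ → Prop) (m n : ℕ) : Fin n → Fin n → Prop :=
  fun k l => r (m + (k : ℕ)) (m + (l : ℕ))

/-- The factor complexity of an infinite permutation. -/
noncomputable def permComplexity (r : ℕ → ℕ → Prop) (n : ℕ) : ℕ :=
  Set.ncard {f : Fin n → Fin n → Prop | ∃ m, f = permFactor r m n}

open Classical in
/-- The underlying binary word of an infinite permutation. -/
noncomputable def underlying (r : ℕ → ℕ → Prop) : ℕ → ℕ :=
  fun i => if r i (i+1) then 0 else 1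

/-- The factor of length `n` of the infinite word `w` at position `m`. -/
def factorAt (w : ℕ → ℕ) (m n : ℕ) : List ℕ :=
  (List.range n).map fun k => w (m + k)

/-- `u` is a factor of the infinite word `w`. -/
def IsFactor (w : ℕ → ℕ) (u : List ℕ) : Prop :=
  ∃ m, u = factorAt w m u.length

/-- The factor complexity of an infinite word. -/
noncomputable def wordComplexity (w : ℕ → ℕ) (n : ℕ) : ℕ :=
  Set.ncard {u : List ℕ | ∃ m, u = factorAt w m n}

def LeftSpecial (w : ℕ → ℕ) (u : List ℕ) : Prop :=
  IsFactor w (0 :: u) ∧ IsFactor w (1 :: u)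

def RightSpecial (w : ℕ → ℕ) (u : List ℕ) : Prop :=
  IsFactor w (u ++ [0]) ∧ IsFactor w (u ++ [1])

def Bispecial (w : ℕ → ℕ) (u : List ℕ) : Prop :=
  LeftSpecial w u ∧ RightSpecial w u

/-- A Christoffel word for `w`: `0b1` or `1b0` with `b` a bispecial factor of `w`. -/
def IsChristoffel (w : ℕ → ℕ) (u : List ℕ) : Prop :=
  ∃ b, Bispecial w b ∧ (u = 0 :: (b ++ [1]) ∨ u = 1 :: (b ++ [0]))

/-- The Sturmian word `s_{σ,ρ}`. -/
noncomputable def sturmianWord (σ ρ : ℝ) : ℕ → ℕ :=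
  fun k => if Int.fract (ρ + (k : ℝ) * σ) < 1 - σ then 0 else 1

/-- The word `w` is ultimately `p`-periodic. -/
def UltPeriodicWord (w : ℕ → ℕ) (p : ℕ) : Prop :=
  ∃ N : ℕ, ∀ i ≥ N, w (i + p) = w i

/-- The word defined by `s[k] = ⌊(k+1)σ⌋ − ⌊kσ⌋`. -/
noncomputable def floorWord (σ : ℝ) : ℕ → ℕ :=
  fun k => (⌊((k : ℝ) + 1) * σ⌋ - ⌊(k : ℝ) * σ⌋).toNat


theorem stmt1 (r : ℕ → ℕ → Prop) (h : EquidistPerm r) :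
    ¬ ∃ t : ℕ, 1 ≤ t ∧ UltPeriodicPerm r t := by
  rintro ⟨t, ht, n0, hp⟩
  obtain ⟨a, ⟨hI, hinj, heq⟩, hrep⟩ := h
  have hper : ∀ i ≥ n0, ∀ j ≥ n0, (a i < a j ↔ a (i+t) < a (j+t)) := by
    intro i hi j hj
    rw [← hrep, ← hrep]
    exact hp i hi j hj
  -- each residue class converges
  have hconv : ∀ k : Fin t, ∃ L : ℝ,
      Tendsto (fun m : ℕ => a (n0 + k + t * m)) atTop (nhds L) := by
    intro k
    have hstep : ∀ m : ℕ, (a (n0 + k + t * 0) < a (n0 + k + t * 1) ↔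
        a (n0 + k + t * m) < a (n0 + k + t * (m + 1))) := by
      intro m
      induction m with
      | zero => rfl
      | succ m ih =>
        rw [ih]
        have := hper (n0 + k + t * m) (by omega) (n0 + k + t * (m+1)) (by omega)
        rw [this]
        simp only [Nat.mul_succ, ← Nat.add_assoc]
    by_cases h0 : a (n0 + k + t * 0) < a (n0 + k + t * 1)
    · refine ⟨_, tendsto_atTop_ciSup (monotone_nat_of_le_succ fun m => ((hstep m).1 h0).le) ?_⟩
      exact ⟨1, by rintro _ ⟨m, rfl⟩; exact (hI _).2⟩
    · refine ⟨_, tendsto_atTop_ciInf (antitone_nat_of_succ_le fun m =>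
        not_lt.1 (fun hh => h0 ((hstep m).2 hh))) ?_⟩
      exact ⟨0, by rintro _ ⟨m, rfl⟩; exact (hI _).1⟩
  choose L hL using hconv
  have hfin : (Set.range L).Finite := Set.finite_range L
  have hne : (Set.Ioo (0:ℝ) 1 \ Set.range L).Nonempty :=
    ((Set.Ioo_infinite (by norm_num : (0:ℝ) < 1)).sdiff hfin).nonempty
  obtain ⟨u, hu⟩ := hne
  have hopen : IsOpen (Set.Ioo (0:ℝ) 1 \ Set.range L) := isOpen_Ioo.sdiff hfin.isClosed
  obtain ⟨e, he, hball⟩ := Metric.isOpen_iff.1 hopen u hu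
  have hsub : Set.Icc u (u + e/2) ⊆ Set.Ioo (0:ℝ) 1 \ Set.range L := by
    intro y hy
    apply hball
    rw [Metric.mem_ball, Real.dist_eq, abs_of_nonneg (by linarith [hy.1])]
    linarith [hy.2]
  have hev : ∀ᶠ m : ℕ in atTop, ∀ k : Fin t, a (n0 + k + t * m) ∈ (Set.Icc u (u + e/2))ᶜ := by
    rw [eventually_all]
    intro k
    refine (hL k).eventually_mem (isClosed_Icc.isOpen_compl.mem_nhds ?_)
    intro hk
    exact (hsub hk).2 ⟨k, rfl⟩
  obtain ⟨M, hM⟩ := eventually_atTop.1 hev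
  have hout : ∀ n ≥ n0 + t * M, a n ∉ Set.Icc u (u + e/2) := by
    intro n hn
    have h1 : M ≤ (n - n0) / t := by
      rw [Nat.le_div_iff_mul_le (by omega), mul_comm]
      omega
    have h2 := hM _ h1 ⟨(n - n0) % t, Nat.mod_lt _ (by omega)⟩
    have h3 : n0 + (n - n0) % t + t * ((n - n0) / t) = n := by
      have := Nat.mod_add_div (n - n0) t
      have h4 : n0 ≤ n := le_trans (Nat.le_add_right _ _) hn
      omega
    simp only [h3] at h2
    exact h2
  have hcard : ∀ n : ℕ, ((Finset.range n).filter fun i => a i < u + e/2).card ≤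
      ((Finset.range n).filter fun i => a i < u).card + (n0 + t * M) := by
    intro n
    have : ((Finset.range n).filter fun i => a i < u + e/2) ⊆
        ((Finset.range n).filter fun i => a i < u) ∪ Finset.range (n0 + t * M) := by
      intro i hi
      simp only [Finset.mem_union, Finset.mem_filter, Finset.mem_range] at hi ⊢
      by_contra hc
      push Not at hc
      exact hout i hc.2 ⟨hc.1 hi.1, hi.2.le⟩
    refine (Finset.card_le_card this).trans ((Finset.card_union_le _ _).trans ?_)
    rw [Finset.card_range]
  have hv := hsub (Set.right_mem_Icc.2 (by linarith : u ≤ u + e/2))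
  have t1 := heq u ⟨hu.1.1.le, hu.1.2.le⟩
  have t2 := heq (u + e/2) ⟨hv.1.1.le, hv.1.2.le⟩
  have t3 := t1.add (tendsto_const_div_atTop_nhds_zero_nat ((n0 + t * M : ℕ) : ℝ))
  have := le_of_tendsto_of_tendsto' t2 t3 (by
    intro n
    rw [← add_div]
    apply div_le_div_of_nonneg_right _ (Nat.cast_nonneg n)
    exact_mod_cast hcard n)
  linarith
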